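/- (Dual iterate stability bound for DPA.) Let z = (x,u) be any saddle point of the Lagrangian L, let (x⁰,q̄⁰,q⁰) with q⁰ = q̄⁰ initialize the DPA iteration, and set z⁰ = (x⁰,q⁰). Then for every N ≥ 1 and every 1 ≤ k ≤ N, the dual iterate satisfies ‖u^k − u‖_{Γ⁻¹} ≤ 2N‖Γ^{1/2}‖δ + √(2V(z⁰−z)). -/

import Mathlib

open scoped RealInnerProductSpace
open Matrix Finset

/-- L2 operator norm of a real matrix acting between Euclidean spaces. -/
noncomputable def opNorm {m n : ℕ} (M : Matrix (Fin m) (Fin n) ℝ) : ℝ :=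
  ‖LinearMap.toContinuousLinearMap (Matrix.toEuclideanLin M)‖

/-- Matrix acting on a Euclidean vector. -/
noncomputable def mApp {m n : ℕ} (M : Matrix (Fin m) (Fin n) ℝ)
    (x : EuclideanSpace ℝ (Fin n)) : EuclideanSpace ℝ (Fin m) :=
  Matrix.toEuclideanLin M x

/-- Weighted squared norm `∑ i, g i * (x i)^2` (e.g. `‖x‖²_{Σ⁻¹}` with `g = σ⁻¹`). -/
noncomputable def wNormSq {n : ℕ} (g : Fin n → ℝ) (x : EuclideanSpace ℝ (Fin n)) : ℝ :=
  ∑ i, g i * x i ^ 2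

/-- The stability estimate for the dual iterates, in coordinates where the preconditioners
are the identity and the saddle point is the origin. -/
theorem norm_dual_le_of_primal_dual_step {E F : Type*} [NormedAddCommGroup E]
    [InnerProductSpace ℝ E] [NormedAddCommGroup F] [InnerProductSpace ℝ F]
    (B : E →L[ℝ] F) (hB : ‖B‖ ≤ 1) (ξ : ℕ → E) (v r : ℕ → F) (e : F)
    (h0 : ⟪ξ 0 - ξ 1, -ξ 1⟫ + ⟪r 0, B (ξ 1)⟫ ≤ 0)
    (hs : ∀ k, ⟪ξ (k + 1) - ξ (k + 2), -ξ (k + 2)⟫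
      + ⟪r (k + 1) + (v (k + 1) - r k), B (ξ (k + 2))⟫ ≤ 0)
    (hv : ∀ k, v (k + 1) = r k + B (ξ (k + 1)) - e)
    (hr : ∀ k, ‖r (k + 1)‖ ≤ ‖v (k + 1)‖) (k : ℕ) :
    ‖v (k + 1)‖ ≤ Real.sqrt (‖ξ 0‖ ^ 2 + ‖r 0‖ ^ 2) + (k + 1) * ‖e‖ := by
  have hBn : ∀ y, ‖B y‖ ^ 2 ≤ ‖y‖ ^ 2 := fun y => by
    have := B.le_of_opNorm_le hB y
    gcongr
    simpa using this
  set D := Real.sqrt (‖ξ 0‖ ^ 2 + ‖r 0‖ ^ 2)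
  have hD0 : 0 ≤ D := Real.sqrt_nonneg _
  have hD2 : D ^ 2 = ‖ξ 0‖ ^ 2 + ‖r 0‖ ^ 2 := Real.sq_sqrt (by positivity)
  have first : ‖ξ 1‖ ^ 2 + ‖v 1 + e‖ ^ 2 ≤ D ^ 2 + ‖B (ξ 1)‖ ^ 2 := by
    have hve : v 1 + e = r 0 + B (ξ 1) := by rw [hv 0]; simp
    have := sq_nonneg ‖ξ 0 - ξ 1‖
    rw [hve, hD2, norm_add_sq_real]
    rw [norm_sub_sq_real] at this
    simp only [inner_sub_left, inner_neg_right, real_inner_self_eq_norm_sq] at h0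
    linarith
  have v1 : ‖v 1‖ ≤ D + ‖e‖ := by
    have h1 : ‖v 1 + e‖ ≤ D := by
      refine (sq_le_sq₀ (norm_nonneg _) hD0).1 ?_
      have := hBn (ξ 1)
      linarith
    have h2 : ‖v 1‖ ≤ ‖v 1 + e‖ + ‖e‖ := by
      simpa using norm_sub_le (v 1 + e) e
    linarith
  have step : ∀ k, ‖ξ (k + 2)‖ ^ 2 + ‖v (k + 2)‖ ^ 2 + ‖B (ξ (k + 1))‖ ^ 2
      ≤ ‖ξ (k + 1)‖ ^ 2 + (‖v (k + 1)‖ + ‖e‖) ^ 2 := by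
    intro k
    have h1 := hs k
    have h2 := hBn (ξ (k + 1) - ξ (k + 2))
    have h3 : ‖r (k + 1) - e‖ ^ 2 ≤ (‖v (k + 1)‖ + ‖e‖) ^ 2 := by
      gcongr
      exact (norm_sub_le _ _).trans (add_le_add (hr k) le_rfl)
    have h4 : ‖v (k + 2)‖ ^ 2 = ‖(r (k + 1) - e) + B (ξ (k + 2))‖ ^ 2 := by
      rw [hv (k + 1)]; congr 2; abel
    have h5 : r (k + 1) + (v (k + 1) - r k) = (r (k + 1) - e) + B (ξ (k + 1)) := by
      rw [hv k]; abel
    rw [norm_add_sq_real] at h4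
    rw [h5, inner_add_left] at h1
    rw [map_sub, norm_sub_sq_real, norm_sub_sq_real] at h2
    simp only [inner_sub_left, inner_neg_right, real_inner_self_eq_norm_sq] at h1 h4
    linarith
  have tail : ∀ k : ℕ, ‖ξ (k + 2)‖ ^ 2 + ‖v (k + 2)‖ ^ 2 ≤ (D + (k + 2) * ‖e‖) ^ 2 := by
    intro k
    induction k with
    | zero =>
      have h1 := step 0
      have h2 : ‖v 1‖ ^ 2 - 2 * (‖v 1‖ * ‖e‖) + ‖e‖ ^ 2 ≤ ‖v 1 + e‖ ^ 2 := by
        have h3 := neg_le_of_abs_le (abs_real_inner_le_norm (v 1) e)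
        rw [norm_add_sq_real]
        linarith
      have h5 : ‖e‖ * ‖v 1‖ ≤ ‖e‖ * (D + ‖e‖) := by gcongr
      simp only [zero_add, Nat.cast_zero] at *
      linarith
    | succ k ih =>
      have h1 := step (k + 1)
      have h2 : ‖v (k + 2)‖ ≤ D + (k + 2) * ‖e‖ := by
        refine (sq_le_sq₀ (norm_nonneg _) (by positivity)).1 ?_
        have := sq_nonneg ‖ξ (k + 2)‖
        linarith
      have h3 : ‖e‖ * ‖v (k + 2)‖ ≤ ‖e‖ * (D + (k + 2) * ‖e‖) := by gcongr
      have h4 := sq_nonneg ‖B (ξ (k + 2))‖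
      push_cast
      simp only [add_assoc, Nat.reduceAdd] at *
      nlinarith
  cases k with
  | zero => simpa using v1
  | succ k =>
    refine (sq_le_sq₀ (norm_nonneg _) (by positivity)).1 ?_
    have := tail k
    have h2 := sq_nonneg ‖ξ (k + 2)‖
    push_cast
    rw [show (k : ℝ) + 1 + 1 = k + 2 by ring]
    linarith

theorem mApp_mul {l m n : ℕ} (M : Matrix (Fin l) (Fin m) ℝ) (K : Matrix (Fin m) (Fin n) ℝ)
    (x : EuclideanSpace ℝ (Fin n)) : mApp (M * K) x = mApp M (mApp K x) := by
  simp [mApp, Matrix.toLpLin_apply]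

theorem mApp_sub {m n : ℕ} (M : Matrix (Fin m) (Fin n) ℝ) (x y : EuclideanSpace ℝ (Fin n)) :
    mApp M (x - y) = mApp M x - mApp M y :=
  map_sub _ x y

theorem mApp_add {m n : ℕ} (M : Matrix (Fin m) (Fin n) ℝ) (x y : EuclideanSpace ℝ (Fin n)) :
    mApp M (x + y) = mApp M x + mApp M y :=
  map_add _ x y

theorem mApp_neg {m n : ℕ} (M : Matrix (Fin m) (Fin n) ℝ) (x : EuclideanSpace ℝ (Fin n)) :
    mApp M (-x) = -mApp M x :=
  map_neg _ x

theorem mApp_diagonal_apply {n : ℕ} (g : Fin n → ℝ) (x : EuclideanSpace ℝ (Fin n)) (i : Fin n) :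
    mApp (Matrix.diagonal g) x i = g i * x i := by
  simp [mApp, Matrix.toLpLin_apply, Matrix.mulVec_diagonal]

theorem inner_mApp_transpose {m n : ℕ} (M : Matrix (Fin m) (Fin n) ℝ)
    (y : EuclideanSpace ℝ (Fin m)) (x : EuclideanSpace ℝ (Fin n)) :
    ⟪mApp Mᵀ y, x⟫ = ⟪y, mApp M x⟫ := by
  have h := LinearMap.adjoint_inner_left (Matrix.toEuclideanLin M) x y
  rwa [← Matrix.toEuclideanLin_conjTranspose_eq_adjoint,
    Matrix.conjTranspose_eq_transpose_of_trivial] at h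

theorem norm_mApp_le {m n : ℕ} (M : Matrix (Fin m) (Fin n) ℝ) (x : EuclideanSpace ℝ (Fin n)) :
    ‖mApp M x‖ ≤ opNorm M * ‖x‖ :=
  (LinearMap.toContinuousLinearMap (Matrix.toEuclideanLin M)).le_opNorm x

theorem inner_mApp_diagonal {n : ℕ} (g h : Fin n → ℝ) (x y : EuclideanSpace ℝ (Fin n)) :
    ⟪mApp (Matrix.diagonal g) x, mApp (Matrix.diagonal h) y⟫
      = ⟪mApp (Matrix.diagonal fun i => g i * h i) x, y⟫ := by
  simp only [PiLp.inner_apply, mApp_diagonal_apply, RCLike.inner_apply, conj_trivial]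
  exact Finset.sum_congr rfl fun i _ => by ring

/-- `wNormSq g⁻¹` is the squared Euclidean norm after rescaling by `g^{-1/2}`. -/
theorem wNormSq_inv_eq {n : ℕ} {g : Fin n → ℝ} (hg : ∀ i, 0 < g i)
    (x : EuclideanSpace ℝ (Fin n)) :
    wNormSq (fun i => (g i)⁻¹) x = ‖mApp (Matrix.diagonal fun i => (Real.sqrt (g i))⁻¹) x‖ ^ 2 := by
  simp only [wNormSq, EuclideanSpace.norm_sq_eq, mApp_diagonal_apply, Real.norm_eq_abs, sq_abs,
    mul_pow, inv_pow, Real.sq_sqrt (hg _).le]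

theorem mApp_diagonal_sqrt_inv {n : ℕ} {g : Fin n → ℝ} (hg : ∀ i, 0 < g i)
    (x : EuclideanSpace ℝ (Fin n)) :
    mApp (Matrix.diagonal fun i => Real.sqrt (g i))
      (mApp (Matrix.diagonal fun i => (Real.sqrt (g i))⁻¹) x) = x := by
  ext i
  simp only [mApp_diagonal_apply]
  rw [mul_inv_cancel_left₀ (Real.sqrt_pos.2 (hg i)).ne']

theorem mApp_diagonal_sqrt_inv_self {n : ℕ} {g : Fin n → ℝ} (hg : ∀ i, 0 < g i)
    (x : EuclideanSpace ℝ (Fin n)) :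
    mApp (Matrix.diagonal fun i => (Real.sqrt (g i))⁻¹) (mApp (Matrix.diagonal g) x)
      = mApp (Matrix.diagonal fun i => Real.sqrt (g i)) x := by
  ext i
  simp only [mApp_diagonal_apply]
  have h := Real.mul_self_sqrt (hg i).le
  have := (Real.sqrt_pos.2 (hg i)).ne'
  field_simp
  rw [sq, h]

theorem inner_mApp_diagonal_sqrt_inv {n : ℕ} {g : Fin n → ℝ} (hg : ∀ i, 0 < g i)
    (x y : EuclideanSpace ℝ (Fin n)) :
    ⟪mApp (Matrix.diagonal fun i => (Real.sqrt (g i))⁻¹) x,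
      mApp (Matrix.diagonal fun i => (Real.sqrt (g i))⁻¹) y⟫
      = ⟪mApp (Matrix.diagonal fun i => (g i)⁻¹) x, y⟫ := by
  rw [inner_mApp_diagonal]
  simp only [← mul_inv, Real.mul_self_sqrt (hg _).le]

theorem inner_mApp_diagonal_inv_sqrt {n : ℕ} {g : Fin n → ℝ} (hg : ∀ i, 0 < g i)
    (x y : EuclideanSpace ℝ (Fin n)) :
    ⟪mApp (Matrix.diagonal fun i => (Real.sqrt (g i))⁻¹) x,
      mApp (Matrix.diagonal fun i => Real.sqrt (g i)) y⟫ = ⟪x, y⟫ := by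
  rw [inner_mApp_diagonal]
  simp only [inv_mul_cancel₀ (Real.sqrt_pos.2 (hg _)).ne', Matrix.diagonal_one]
  simp [mApp]

theorem dpa_dual_iterate_bound
    {p d m : ℕ} (hp : 0 < p) (hd : 0 < d)
    (A : Matrix (Fin d) (Fin p) ℝ)
    (b bδ : EuclideanSpace ℝ (Fin d)) (δ : ℝ) (hδ : 0 ≤ δ) (hbδ : ‖bδ - b‖ ≤ δ)
    (J : EuclideanSpace ℝ (Fin p) → ℝ) (hJ : ConvexOn ℝ Set.univ J)
    -- diagonal positive definite preconditioners Σ = diagonal σ, Γ = diagonal γ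
    (σ : Fin p → ℝ) (γ : Fin d → ℝ) (hσ : ∀ i, 0 < σ i) (hγ : ∀ i, 0 < γ i)
    -- α := 1 - ‖Γ^{1/2} A Σ^{1/2}‖² > 0
    (α : ℝ)
    (hα : α = 1 - opNorm (Matrix.diagonal (fun i => Real.sqrt (γ i)) * A *
      Matrix.diagonal (fun j => Real.sqrt (σ j))) ^ 2)
    (hαpos : 0 < α)
    -- the exact and noisy Lagrangians
    (L Lδ : EuclideanSpace ℝ (Fin p) → EuclideanSpace ℝ (Fin d) → ℝ)
    (hL : ∀ x u, L x u = J x + ⟪u, mApp A x - b⟫)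
    (hLδ : ∀ x u, Lδ x u = J x + ⟪u, mApp A x - bδ⟫)
    -- dual solution sets: second components of saddle points of L resp. Lδ
    (Sstar Sstarδ : Set (EuclideanSpace ℝ (Fin d)))
    (hSstar : Sstar = {v | ∃ z, ∀ y w, L z w ≤ L z v ∧ L z v ≤ L y v})
    (hSstarδ : Sstarδ = {v | ∃ z, ∀ y w, Lδ z w ≤ Lδ z v ∧ Lδ z v ≤ Lδ y v})
    -- the activation operators and Assumption A4
    (T : Fin m → EuclideanSpace ℝ (Fin d) → EuclideanSpace ℝ (Fin d))
    (hTfix : ∀ i v, v ∈ Sstarδ → T i v = v)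
    (hTstab : ∀ i (v vbar : EuclideanSpace ℝ (Fin d)), vbar ∈ Sstarδ ∪ Sstar →
      wNormSq (fun j => (γ j)⁻¹) (T i v - vbar) ≤ wNormSq (fun j => (γ j)⁻¹) (v - vbar))
    (ε : ℕ → Fin m)
    -- the DPA iteration
    (x : ℕ → EuclideanSpace ℝ (Fin p)) (u q qbar : ℕ → EuclideanSpace ℝ (Fin d))
    (hinit : q 0 = qbar 0)
    (hx : ∀ k (y : EuclideanSpace ℝ (Fin p)),
      J (x (k + 1)) + ⟪mApp (Matrix.diagonal fun j => (σ j)⁻¹) (x k - x (k + 1)) -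
        mApp Aᵀ (qbar k), y - x (k + 1)⟫ ≤ J y)
    (hu : ∀ k, u (k + 1) = q k + mApp (Matrix.diagonal γ) (mApp A (x (k + 1)) - bδ))
    (hq : ∀ k, q (k + 1) = T (ε (k + 1)) (u (k + 1)))
    (hqbar : ∀ k, qbar (k + 1) = q (k + 1) + u (k + 1) - q k)
    -- a saddle point z = (xs, us) of the Lagrangian
    (xs : EuclideanSpace ℝ (Fin p)) (us : EuclideanSpace ℝ (Fin d))
    (hsaddle : ∀ y v, L xs v ≤ L xs us ∧ L xs us ≤ L y us)
    -- V(z⁰ - z) with z⁰ = (x⁰, q⁰)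
    (V0 : ℝ)
    (hV0 : V0 = wNormSq (fun j => (σ j)⁻¹) (x 0 - xs) / 2
      + wNormSq (fun i => (γ i)⁻¹) (q 0 - us) / 2)
    -- ‖Γ^{1/2}‖
    (gh : ℝ) (hgh : gh = opNorm (Matrix.diagonal (fun i => Real.sqrt (γ i))))
    (N : ℕ) (hN : 1 ≤ N) (k : ℕ) (hk1 : 1 ≤ k) (hkN : k ≤ N) :
    Real.sqrt (wNormSq (fun i => (γ i)⁻¹) (u k - us))
      ≤ 2 * (N : ℝ) * gh * δ + Real.sqrt (2 * V0) := by
  have hfeas : mApp A xs = b := by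
    have h := (hsaddle xs (us + (mApp A xs - b))).1
    rw [hL, hL, inner_add_left, real_inner_self_eq_norm_sq] at h
    have h2 : ‖mApp A xs - b‖ ^ 2 = 0 := le_antisymm (by linarith) (sq_nonneg _)
    exact sub_eq_zero.1 (norm_eq_zero.1 (pow_eq_zero_iff two_ne_zero |>.1 h2))
  have hus : us ∈ Sstarδ ∪ Sstar := by
    right
    rw [hSstar]
    exact ⟨xs, hsaddle⟩
  have hprimal : ∀ k, ⟪mApp (Matrix.diagonal fun j => (σ j)⁻¹) (x k - x (k + 1)),
      xs - x (k + 1)⟫ + ⟪qbar k - us, mApp A (x (k + 1) - xs)⟫ ≤ 0 := by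
    intro k
    have h1 := hx k xs
    have h2 := (hsaddle (x (k + 1)) us).2
    rw [hL, hL, hfeas, sub_self, inner_zero_right] at h2
    rw [inner_sub_left, inner_mApp_transpose, mApp_sub A, hfeas, inner_sub_right (qbar k)] at h1
    rw [mApp_sub A, hfeas, inner_sub_left, inner_sub_right (qbar k)]
    linarith
  set G := Matrix.diagonal fun i => Real.sqrt (γ i)
  set G' := Matrix.diagonal fun i => (Real.sqrt (γ i))⁻¹
  set S := Matrix.diagonal fun i => Real.sqrt (σ i)
  set S' := Matrix.diagonal fun i => (Real.sqrt (σ i))⁻¹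
  set B := LinearMap.toContinuousLinearMap (Matrix.toEuclideanLin (G * A * S))
  have hB : ‖B‖ ≤ 1 := by
    have h : ‖B‖ ^ 2 ≤ 1 ^ 2 := by
      have : α = 1 - ‖B‖ ^ 2 := hα
      linarith
    exact (sq_le_sq₀ (norm_nonneg _) zero_le_one).1 h
  have hBapp : ∀ y, B (mApp S' y) = mApp G (mApp A y) := by
    intro y
    change mApp (G * A * S) (mApp S' y) = _
    rw [mApp_mul, mApp_mul, mApp_diagonal_sqrt_inv hσ]
  have hscaled : ∀ k (w : EuclideanSpace ℝ (Fin d)), qbar k - us = w →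
      ⟪mApp S' (x k - xs) - mApp S' (x (k + 1) - xs), -mApp S' (x (k + 1) - xs)⟫
        + ⟪mApp G' w, B (mApp S' (x (k + 1) - xs))⟫ ≤ 0 := by
    rintro k _ rfl
    rw [hBapp, inner_mApp_diagonal_inv_sqrt hγ, ← mApp_sub, ← mApp_neg,
      inner_mApp_diagonal_sqrt_inv hσ, neg_sub, sub_sub_sub_cancel_right]
    exact hprimal k
  obtain ⟨n, rfl⟩ : ∃ n, k = n + 1 := ⟨k - 1, by omega⟩
  have key := norm_dual_le_of_primal_dual_step B hB (fun k => mApp S' (x k - xs))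
    (fun k => mApp G' (u k - us)) (fun k => mApp G' (q k - us)) (mApp G (bδ - b))
    (hscaled 0 _ (by rw [hinit]))
    (fun k => by
      rw [← mApp_sub G', ← mApp_add]
      exact hscaled (k + 1) _ (by rw [hqbar]; abel))
    (fun k => by
      rw [hBapp, hu, ← mApp_diagonal_sqrt_inv_self hγ, ← mApp_diagonal_sqrt_inv_self hγ,
        ← mApp_add, ← mApp_sub, mApp_sub A, hfeas]
      rw [add_sub_assoc (q k - us), ← mApp_sub, sub_sub_sub_cancel_right, sub_add_eq_add_sub])
    (fun k => by
      have h := hTstab (ε (k + 1)) (u (k + 1)) us hus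
      rw [← hq, wNormSq_inv_eq hγ, wNormSq_inv_eq hγ] at h
      exact (sq_le_sq₀ (norm_nonneg _) (norm_nonneg _)).1 h) n
  have hV : 2 * V0 = ‖mApp S' (x 0 - xs)‖ ^ 2 + ‖mApp G' (q 0 - us)‖ ^ 2 := by
    rw [hV0, wNormSq_inv_eq hσ, wNormSq_inv_eq hγ]
    ring
  have hgh0 : 0 ≤ gh := hgh ▸ norm_nonneg _
  have he : ‖mApp G (bδ - b)‖ ≤ gh * δ := by
    rw [hgh]
    exact (norm_mApp_le _ _).trans (mul_le_mul_of_nonneg_left hbδ (norm_nonneg _))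
  have hnN : (n : ℝ) + 1 ≤ 2 * N := by
    have : n + 1 ≤ 2 * N := by omega
    exact_mod_cast this
  have hnoise : ((n : ℝ) + 1) * ‖mApp G (bδ - b)‖ ≤ 2 * N * (gh * δ) := by
    gcongr
  rw [wNormSq_inv_eq hγ, Real.sqrt_sq (norm_nonneg _), hV]
  linarith
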